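/- Let D < 0 be a fundamental discriminant with |D| > e^{11.2}. If L(s, χ_D) ≠ 0 for all real s with 1 − 1/(4·log|D|) ≤ s < 1, then the class number satisfies h(D) > (0.655/(π·e)) · √|D| / log|D|. -/

import Mathlib

open NumberField

/-- `D` is a fundamental discriminant: either `D ≡ 1 (mod 4)` and `D` is squarefree,
or `D = 4m` for a squarefree integer `m ≡ 2` or `3 (mod 4)`. (We exclude the degenerate
case `D = 1`, so that `D` is the discriminant of a quadratic number field.) -/
def IsFundamentalDiscriminant (D : ℤ) : Prop :=
  D ≠ 1 ∧ ((D % 4 = 1 ∧ Squarefree D) ∨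
    ∃ m : ℤ, D = 4 * m ∧ Squarefree m ∧ (m % 4 = 2 ∨ m % 4 = 3))

/-- `χ` is the Kronecker character attached to the fundamental discriminant `D`: the (unique)
Dirichlet character modulo `|D|` with `χ(p) = (D/p)` (Legendre symbol) for every odd prime
`p ∤ D`. -/
def IsKroneckerChar (D : ℤ) (χ : DirichletCharacter ℂ D.natAbs) : Prop :=
  ∀ (p : ℕ) (hp : p.Prime), p ≠ 2 → ¬ ((p : ℤ) ∣ D) →
    χ (p : ZMod D.natAbs) = ((@legendreSym p ⟨hp⟩ D : ℤ) : ℂ)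

/-- The analytically continued Dirichlet L-function, extended by the junk value `0` for
modulus `0`. -/
noncomputable def LFunc {N : ℕ} (χ : DirichletCharacter ℂ N) (s : ℂ) : ℂ :=
  if h : N = 0 then 0 else
    letI : NeZero N := ⟨h⟩
    DirichletCharacter.LFunction χ s

/-- The ring of integers of a quadratic field has a `ℤ`-basis of the form `1, ω`. -/
theorem exists_integral_basis_one {K : Type*} [Field K] [NumberField K]
    (hK : Module.finrank ℚ K = 2) :
    ∃ b : Module.Basis (Fin 2) ℤ (𝓞 K), b 0 = 1 := by
  have h2 : Module.finrank ℤ (𝓞 K) = 2 := by rw [RingOfIntegers.rank, hK]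
  let e := Module.finBasisOfFinrankEq ℤ (𝓞 K) h2
  obtain ⟨x, hx⟩ : ∃ x, x = e.repr 1 0 := ⟨_, rfl⟩
  obtain ⟨y, hy⟩ : ∃ y, y = e.repr 1 1 := ⟨_, rfl⟩
  have h1 : (1 : 𝓞 K) = x • e 0 + y • e 1 := by
    have := e.sum_repr 1
    rw [Fin.sum_univ_two] at this
    rw [hx, hy, this]
  have hcop : IsCoprime x y := by
    rw [Int.isCoprime_iff_gcd_eq_one]
    obtain ⟨x', hx'⟩ := Int.gcd_dvd_left x y
    obtain ⟨y', hy'⟩ := Int.gcd_dvd_right x y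
    have hu : IsUnit ((Int.gcd x y : ℤ) : 𝓞 K) := by
      refine IsUnit.of_mul_eq_one (x' • e 0 + y' • e 1) ?_
      rw [← zsmul_eq_mul, smul_add, smul_smul, smul_smul, ← hx', ← hy', ← h1]
    have := (hu.map (Algebra.norm ℤ))
    rw [← eq_intCast (algebraMap ℤ (𝓞 K)), Algebra.norm_algebraMap, h2] at this
    have h3 := isUnit_pow_iff (two_ne_zero) |>.1 this
    simpa using Int.isUnit_iff_natAbs_eq.1 h3
  obtain ⟨u, v, huv⟩ := hcop
  have hdet : (Matrix.of ![![x, y], ![-v, u]]).det = 1 := by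
    rw [Matrix.det_fin_two]; simp; linarith
  let w : Fin 2 → 𝓞 K := ![1, (-v) • e 0 + u • e 1]
  have hw : e.toMatrix w = (Matrix.of ![![x, y], ![-v, u]]).transpose := by
    ext i j
    fin_cases i <;> fin_cases j <;> simp [w, Module.Basis.toMatrix_apply, hx, hy, -zsmul_eq_mul]
  have hunit : IsUnit (e.toMatrix w) := by
    rw [hw, Matrix.isUnit_iff_isUnit_det, Matrix.det_transpose, hdet]; exact isUnit_one
  have hb := (e.is_basis_iff_det (v := w)).2 (by
    rw [Module.Basis.det_apply]; exact (Matrix.isUnit_iff_isUnit_det _).1 hunit)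
  refine ⟨Module.Basis.mk hb.1 hb.2.ge, by simp [w]⟩

/-- In a quadratic field, the ring of integers is `ℤ[ω]` with `ω ^ 2 = t ω - n` and
`discr K = t ^ 2 - 4 n`; roots of `X ^ 2 - t X + n` modulo `p` give ring homomorphisms to
`ZMod p`. -/
theorem exists_quadratic_generator {K : Type*} [Field K] [NumberField K]
    (hK : Module.finrank ℚ K = 2) :
    ∃ (ω : 𝓞 K) (t n : ℤ), discr K = t ^ 2 - 4 * n ∧
      ∀ (p : ℕ) (x : ZMod p), x ^ 2 - t * x + n = 0 →
        ∃ f : 𝓞 K →+* ZMod p, f ω = x := by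
  obtain ⟨b, hb⟩ := exists_integral_basis_one hK
  have hexp (z : 𝓞 K) : z = ((b.repr z 0 : ℤ) : 𝓞 K) + ((b.repr z 1 : ℤ) : 𝓞 K) * b 1 := by
    have := b.sum_repr z
    rw [Fin.sum_univ_two, hb] at this
    simpa using this.symm
  obtain ⟨ω, hω⟩ : ∃ ω, ω = b 1 := ⟨_, rfl⟩
  rw [← hω] at hexp
  have hrepr (x y : ℤ) : b.repr ((x : 𝓞 K) + y * ω) 0 = x ∧ b.repr ((x : 𝓞 K) + y * ω) 1 = y := by
    have : (x : 𝓞 K) + y * ω = x • b 0 + y • b 1 := by simp [hb, hω]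
    rw [this]; simp [-zsmul_eq_mul]
  obtain ⟨n, hn⟩ : ∃ n, n = - b.repr (ω ^ 2) 0 := ⟨_, rfl⟩
  obtain ⟨t, ht⟩ : ∃ t, t = b.repr (ω ^ 2) 1 := ⟨_, rfl⟩
  have hsq : ω ^ 2 = ((-n : ℤ) : 𝓞 K) + (t : ℤ) * ω := by
    rw [hn, ht, neg_neg]; exact hexp _
  have hmul (z z' : 𝓞 K) : z * z' =
      ((b.repr z 0 * b.repr z' 0 - n * (b.repr z 1 * b.repr z' 1) : ℤ) : 𝓞 K) +
      ((b.repr z 0 * b.repr z' 1 + b.repr z 1 * b.repr z' 0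
        + t * (b.repr z 1 * b.repr z' 1) : ℤ) : 𝓞 K) * ω := by
    conv_lhs => rw [hexp z, hexp z']
    push_cast at hsq ⊢
    linear_combination (((b.repr z 1 : ℤ) : 𝓞 K) * ((b.repr z' 1 : ℤ) : 𝓞 K)) * hsq
  have hone : b.repr 1 0 = 1 ∧ b.repr 1 1 = 0 := by simpa using hrepr 1 0
  have hωr : b.repr ω 0 = 0 ∧ b.repr ω 1 = 1 := by simpa using hrepr 0 1
  have htr (z : 𝓞 K) : Algebra.trace ℤ (𝓞 K) z = 2 * b.repr z 0 + t * b.repr z 1 := by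
    rw [Algebra.trace_eq_matrix_trace b, Matrix.trace_fin_two, Algebra.leftMulMatrix_eq_repr_mul,
      Algebra.leftMulMatrix_eq_repr_mul, hb, mul_one, ← hω, hmul z ω, (hrepr _ _).2, hωr.1, hωr.2]
    ring
  refine ⟨ω, t, n, ?_, fun p x hx ↦ ?_⟩
  · rw [← discr_eq_discr K b, Algebra.discr_def, Matrix.det_fin_two]
    simp only [Algebra.traceMatrix_apply, Algebra.traceForm_apply, hb, ← hω, one_mul, mul_one]
    rw [← pow_two, htr, htr, htr, hone.1, hone.2, hωr.1, hωr.2, hsq, (hrepr _ _).1, (hrepr _ _).2]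
    ring
  · refine ⟨{ toFun := fun z ↦ ((b.repr z 0 : ℤ) : ZMod p) + ((b.repr z 1 : ℤ) : ZMod p) * x
              map_one' := by simp [hone]
              map_zero' := by simp
              map_add' := fun z z' ↦ by simp; ring
              map_mul' := fun z z' ↦ ?_ }, by simp [hωr]⟩
    rw [hmul z z', (hrepr _ _).1, (hrepr _ _).2]
    push_cast
    linear_combination -(((b.repr z 1 : ℤ) : ZMod p) * ((b.repr z' 1 : ℤ) : ZMod p)) * hx

/-- The number of integral ideals of norm `n`. -/
noncomputable def idealCount (K : Type*) [Field K] [NumberField K] (n : ℕ) : ℕ :=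
  Nat.card {I : Ideal (𝓞 K) // Ideal.absNorm I = n}

section idealCount
variable {K : Type*} [Field K] [NumberField K]

instance finite_absNorm_eq (n : ℕ) : Finite {I : Ideal (𝓞 K) // Ideal.absNorm I = n} :=
  (Ideal.finite_setOfPred_absNorm_eq n).to_subtype

theorem one_le_idealCount {n : ℕ} (I : Ideal (𝓞 K)) (hI : Ideal.absNorm I = n) :
    1 ≤ idealCount K n := by
  have : Nonempty {I : Ideal (𝓞 K) // Ideal.absNorm I = n} := ⟨⟨I, hI⟩⟩
  exact Nat.card_pos

theorem idealCount_mul_le {m n : ℕ} (h : m.Coprime n) :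
    idealCount K m * idealCount K n ≤ idealCount K (m * n) := by
  unfold idealCount
  rw [← Nat.card_prod]
  refine Nat.card_le_card_of_injective
    (fun q ↦ ⟨q.1.1 * q.2.1, by rw [map_mul, q.1.2, q.2.2]⟩) ?_
  have key {m n : ℕ} (h : m.Coprime n) (I J : Ideal (𝓞 K)) (hI : Ideal.absNorm I = m)
      (hJ : Ideal.absNorm J = n) : I * J ⊔ Ideal.span {(m : 𝓞 K)} = I := by
    have hm : Ideal.span {(m : 𝓞 K)} ≤ I := by
      rw [Ideal.span_singleton_le_iff_mem, ← hI]; exact Ideal.absNorm_mem I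
    obtain ⟨I', hI'⟩ := Ideal.dvd_iff_le.2 hm
    rw [hI', ← Ideal.mul_sup]
    have : J ⊔ I' = ⊤ := by
      rw [Ideal.eq_top_iff_one]
      have h1 : IsCoprime (m : ℤ) (n : ℤ) := Nat.isCoprime_iff_coprime.2 h
      obtain ⟨u, v, huv⟩ := h1
      have h2 : (u : 𝓞 K) * m + v * n = 1 := by exact_mod_cast congrArg (Int.cast : ℤ → 𝓞 K) huv
      rw [← h2, add_comm]
      refine Submodule.add_mem_sup (J.mul_mem_left _ ?_) (I'.mul_mem_left _ ?_)
      · rw [← hJ]; exact Ideal.absNorm_mem J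
      · have : Ideal.span {(m : 𝓞 K)} ≤ I' := hI' ▸ Ideal.mul_le_right
        exact this (Ideal.mem_span_singleton_self _)
    rw [this, Ideal.mul_top]
  rintro ⟨⟨I, hI⟩, ⟨J, hJ⟩⟩ ⟨⟨I', hI'⟩, ⟨J', hJ'⟩⟩ heq
  simp only [Subtype.mk.injEq] at heq
  have e1 : I = I' := by rw [← key h I J hI hJ, ← key h I' J' hI' hJ', heq]
  have e2 : J = J' := by
    rw [← key h.symm J I hJ hI, ← key h.symm J' I' hJ' hI', mul_comm J, mul_comm J', heq]
  subst e1 e2; rfl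

theorem absNorm_ker_ringHom_zmod {p : ℕ} (f : 𝓞 K →+* ZMod p) :
    Ideal.absNorm (RingHom.ker f) = p := by
  rw [Ideal.absNorm_apply, Submodule.cardQuot_apply]
  rw [Nat.card_congr
    (RingHom.quotientKerEquivOfSurjective (ZMod.ringHom_surjective f)).toEquiv, Nat.card_zmod]

/-- Two distinct primes of norm `p` give `j + 1` ideals of norm `p ^ j`. -/
theorem succ_le_idealCount_pow {p : ℕ} [hp : Fact p.Prime] (f g : 𝓞 K →+* ZMod p)
    (hker : RingHom.ker f ≠ RingHom.ker g) (j : ℕ) : j + 1 ≤ idealCount K (p ^ j) := by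
  set P := RingHom.ker f
  set Q := RingHom.ker g
  have hP : P.IsPrime := RingHom.ker_isPrime f
  have hQ : Q.IsPrime := RingHom.ker_isPrime g
  have nP : Ideal.absNorm P = p := absNorm_ker_ringHom_zmod f
  have nQ : Ideal.absNorm Q = p := absNorm_ker_ringHom_zmod g
  have P0 : P ≠ ⊥ := by rintro h; rw [h, Ideal.absNorm_bot] at nP; exact hp.1.ne_zero nP.symm
  have Q0 : Q ≠ ⊥ := by rintro h; rw [h, Ideal.absNorm_bot] at nQ; exact hp.1.ne_zero nQ.symm
  have hPp : Prime P := Ideal.prime_of_isPrime P0 hP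
  have hQp : Prime Q := Ideal.prime_of_isPrime Q0 hQ
  unfold idealCount
  rw [← Nat.card_fin (j + 1)]
  refine Nat.card_le_card_of_injective
    (fun i : Fin (j + 1) ↦ ⟨P ^ (i : ℕ) * Q ^ (j - i), by
      rw [map_mul, map_pow, map_pow, nP, nQ, ← pow_add]; congr 1; omega⟩) ?_
  have hPQ (n : ℕ) : ¬ P ∣ Q ^ n := fun h ↦
    hker (associated_iff_eq.1 ((Prime.dvd_prime_iff_associated hPp hQp).1 (hPp.dvd_of_dvd_pow h)))
  have hem (i n : ℕ) : emultiplicity P (P ^ i * Q ^ n) = i := by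
    rw [emultiplicity_mul hPp, emultiplicity_pow_self_of_prime hPp,
      emultiplicity_eq_zero.2 (hPQ n), add_zero]
  intro i i' h
  simp only [Subtype.mk.injEq] at h
  have := hem i (j - i)
  rw [h, hem] at this
  ext; exact_mod_cast this.symm

end idealCount

section Kronecker
variable {D : ℤ} {χ : DirichletCharacter ℂ D.natAbs}

theorem IsKroneckerChar.eq_jacobiSym (hχ : IsKroneckerChar D χ) {m : ℕ} (hm : Odd m)
    (hcop : m.Coprime D.natAbs) : χ (m : ZMod D.natAbs) = (jacobiSym D m : ℂ) := by
  induction m using Nat.recOnMul with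
  | zero => simp at hm
  | one => simp
  | prime p hp =>
    have h2 : p ≠ 2 := by rintro rfl; exact absurd hm (by decide)
    have hpD : ¬ (p : ℤ) ∣ D := by
      rw [Int.natCast_dvd]
      exact (Nat.Prime.coprime_iff_not_dvd hp).1 hcop
    have := Fact.mk hp
    rw [hχ p hp h2 hpD, jacobiSym.legendreSym.to_jacobiSym]
  | mul a b iha ihb =>
    rw [Nat.odd_mul] at hm
    have : NeZero a := ⟨by rintro rfl; simp at hm⟩
    have : NeZero b := ⟨by rintro rfl; simp at hm⟩
    rw [Nat.cast_mul, map_mul, iha hm.1 (Nat.Coprime.coprime_mul_right hcop),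
      ihb hm.2 (Nat.Coprime.coprime_mul_left hcop), jacobiSym.mul_right, Int.cast_mul]

theorem IsKroneckerChar.sq_eq_one (hχ : IsKroneckerChar D χ) (hD : D ≠ 0) : χ ^ 2 = 1 := by
  have : NeZero D.natAbs := ⟨Int.natAbs_ne_zero.2 hD⟩
  have key (m : ℕ) (hm : Odd m) (hcop : m.Coprime D.natAbs) :
      χ (m : ZMod D.natAbs) ^ 2 = 1 := by
    rw [hχ.eq_jacobiSym hm hcop]
    have : jacobiSym D m ^ 2 = 1 := jacobiSym.sq_one (by
      rw [Int.gcd_comm]; simpa [Int.gcd] using hcop)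
    exact_mod_cast this
  ext u
  rw [MulChar.pow_apply_coe, MulChar.one_apply_coe]
  obtain ⟨m, hm⟩ : ∃ m : ℕ, m = (u : ZMod D.natAbs).val := ⟨_, rfl⟩
  have hu : (u : ZMod D.natAbs) = (m : ZMod D.natAbs) := by rw [hm, ZMod.natCast_zmod_val]
  have hcop : m.Coprime D.natAbs := by rw [hm]; exact ZMod.val_coe_unit_coprime u
  rw [hu]
  rcases Nat.even_or_odd m with he | ho
  · have hoD : Odd D.natAbs := by
      rw [← Nat.not_even_iff_odd]
      intro h
      have := Nat.dvd_gcd he.two_dvd h.two_dvd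
      rw [hcop] at this; omega
    have h := key (m + D.natAbs) (he.add_odd hoD) (by simpa using hcop)
    simpa using h
  · exact key m ho hcop

theorem IsKroneckerChar.apply_two (hχ : IsKroneckerChar D χ) (hD : D < 0) (hodd : Odd D) :
    χ ((2 : ℕ) : ZMod D.natAbs) = (ZMod.χ₈ ((D.natAbs + 2 : ℕ) : ZMod 8) : ℂ) := by
  have ho : Odd D.natAbs := Int.natAbs_odd.2 hodd
  have ho2 : Odd (D.natAbs + 2) := ho.add_even even_two
  have hcop : (D.natAbs + 2).Coprime D.natAbs := by
    rw [Nat.coprime_self_add_left]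
    exact (Nat.coprime_two_left).2 ho
  have h := hχ.eq_jacobiSym ho2 hcop
  rw [jacobiSym.mod_left, show D % ((D.natAbs + 2 : ℕ) : ℤ) = 2 % ((D.natAbs + 2 : ℕ) : ℤ) from ?_,
    ← jacobiSym.mod_left, jacobiSym.at_two ho2] at h
  · rw [← h]; simp
  · apply Int.emod_emod_of_dvd _ (dvd_refl _) |>.symm.trans
    rw [Int.emod_emod_of_dvd _ (dvd_refl _)]
    apply Int.ModEq.symm
    rw [Int.modEq_iff_dvd]
    refine ⟨-1, ?_⟩
    push_cast
    rw [abs_of_neg hD]; ring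

end Kronecker

section Count
variable {K : Type*} [Field K] [NumberField K]

theorem DirichletCharacter.zetaMul_prime_pow {N : ℕ} (χ : DirichletCharacter ℂ N) {p : ℕ}
    (hp : p.Prime) (j : ℕ) :
    χ.zetaMul (p ^ j) = ∑ i ∈ Finset.range (j + 1), χ (p : ZMod N) ^ i := by
  rw [zetaMul, ArithmeticFunction.coe_zeta_mul_apply, Nat.sum_divisors_prime_pow hp]
  refine Finset.sum_congr rfl fun i _ ↦ ?_
  simp [toArithmeticFunction, hp.ne_zero]

/-- For the Kronecker character of a quadratic discriminant, the number of ideals of norm `n`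
is at least the divisor sum `∑_{d ∣ n} χ(d)`. -/
theorem zetaMul_re_le_idealCount (hK : Module.finrank ℚ K = 2) {D : ℤ} (hD : D < 0)
    (hdisc : discr K = D) {χ : DirichletCharacter ℂ D.natAbs} (hχ : IsKroneckerChar D χ) (n : ℕ)
    (hn : n ≠ 0) :
    (χ.zetaMul n).re ≤ idealCount K n := by
  have hsq := hχ.sq_eq_one hD.ne
  obtain ⟨ω, t, c, htc, hroot⟩ := exists_quadratic_generator hK
  rw [hdisc] at htc
  have key : ∀ a b : ZMod 2, a ^ 2 - 4 * b = 0 → ∃ x, x ^ 2 - a * x + b = 0 := by decide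
  have hroot0 (p : ℕ) [Fact p.Prime] (h : p ∣ D.natAbs) : ∃ x : ZMod p, x ^ 2 - t * x + c = 0 := by
    have hD0 : (t : ZMod p) ^ 2 - 4 * c = 0 := by
      have : ((D : ℤ) : ZMod p) = 0 :=
        (ZMod.intCast_zmod_eq_zero_iff_dvd _ _).2 (Int.natCast_dvd.2 h)
      rw [htc] at this; push_cast at this; exact this
    by_cases hp2 : p = 2
    · subst hp2
      exact key _ _ hD0
    · have h2 : (2 : ZMod p) ≠ 0 := by
        have := ZMod.prime_ne_zero p 2 hp2
        exact_mod_cast this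
      refine ⟨t / 2, ?_⟩
      field_simp
      linear_combination -hD0
  have hroot1 (p : ℕ) [hp : Fact p.Prime] (h : χ (p : ZMod D.natAbs) = 1) :
      ∃ x y : ZMod p, x ≠ y ∧ x ^ 2 - t * x + c = 0 ∧ y ^ 2 - t * y + c = 0 := by
    have hpD : ¬ p ∣ D.natAbs := by
      intro hd
      have : ¬ IsUnit (p : ZMod D.natAbs) := by
        rw [ZMod.isUnit_prime_iff_not_dvd hp.1]; exact not_not.2 hd
      rw [MulChar.map_nonunit χ this] at h
      exact zero_ne_one h
    by_cases hp2 : p = 2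
    · subst hp2
      have hodd : Odd D := by
        rw [← Int.natAbs_odd, ← Nat.not_even_iff_odd, even_iff_two_dvd]; exact hpD
      have hto : Odd t := by
        rw [htc, Int.odd_sub] at hodd
        have : Even (4 * c) := ⟨2 * c, by ring⟩
        exact (Int.odd_pow' two_ne_zero).1 (hodd.2 this)
      have h8 : t ^ 2 % 8 = 1 := by
        obtain ⟨k, rfl⟩ := hto
        obtain ⟨l, hl⟩ := Int.even_mul_succ_self k
        rw [show (2 * k + 1) ^ 2 = 4 * (k * (k + 1)) + 1 by ring, hl]
        omega
      rw [hχ.apply_two hD hodd, ZMod.χ₈_nat_eq_if_mod_eight] at h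
      have hc : c % 2 = 0 := by
        have h' : (if (D.natAbs + 2) % 2 = 0 then 0 else
          if (D.natAbs + 2) % 8 = 1 ∨ (D.natAbs + 2) % 8 = 7 then 1 else -1 : ℤ) = 1 := by
          exact_mod_cast h
        split_ifs at h' with h1 h2
        all_goals omega
      refine ⟨0, 1, zero_ne_one, ?_, ?_⟩
      · have : (c : ZMod 2) = 0 := (ZMod.intCast_zmod_eq_zero_iff_dvd _ _).2 (by omega)
        rw [this]; simp
      · have : (c : ZMod 2) = 0 := (ZMod.intCast_zmod_eq_zero_iff_dvd _ _).2 (by omega)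
        have ht1 : (t : ZMod 2) = 1 := by
          have : ((t - 1 : ℤ) : ZMod 2) = 0 :=
            (ZMod.intCast_zmod_eq_zero_iff_dvd _ _).2 (by obtain ⟨k, rfl⟩ := hto; omega)
          push_cast at this; linear_combination this
        rw [this, ht1]; simp
    · have h2 : (2 : ZMod p) ≠ 0 := by
        have := ZMod.prime_ne_zero p 2 hp2
        exact_mod_cast this
      rw [hχ p hp.1 hp2 (by rwa [Int.natCast_dvd])] at h
      have hl : legendreSym p D = 1 := by exact_mod_cast h
      have hD0 : (D : ZMod p) ≠ 0 := by
        rw [Ne, ZMod.intCast_zmod_eq_zero_iff_dvd, Int.natCast_dvd]; exact hpD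
      obtain ⟨y, hy⟩ := (legendreSym.eq_one_iff p hD0).1 hl
      have hy0 : y ≠ 0 := by rintro rfl; simp at hy; exact hD0 hy
      have htc' : (D : ZMod p) = t ^ 2 - 4 * c := by rw [htc]; push_cast; ring
      refine ⟨(t + y) / 2, (t - y) / 2, ?_, ?_, ?_⟩
      · intro h
        apply hy0
        field_simp at h
        have : 2 * y = 0 := by linear_combination h
        simpa [h2] using this
      · field_simp
        linear_combination -hy + htc'
      · field_simp
        linear_combination -hy + htc'
  induction n using Nat.recOnPosPrimePosCoprime with
  | zero => exact absurd rfl hn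
  | one =>
    rw [(χ.isMultiplicative_zetaMul).map_one]
    have := one_le_idealCount (K := K) (n := 1) ⊤ (by simp)
    simpa using this
  | prime_pow p j hp hj =>
    have := Fact.mk hp
    rw [χ.zetaMul_prime_pow hp]
    have hcase : χ (p : ZMod D.natAbs) = 0 ∨ χ (p : ZMod D.natAbs) = 1 ∨
        χ (p : ZMod D.natAbs) = -1 := MulChar.isQuadratic_iff_sq_eq_one.2 hsq _
    rcases hcase with h | h | h
    · have hpD : p ∣ D.natAbs := by
        by_contra hd
        have : IsUnit (p : ZMod D.natAbs) := (ZMod.isUnit_prime_iff_not_dvd hp).2 hd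
        exact (this.map χ).ne_zero h
      obtain ⟨x, hx⟩ := hroot0 p hpD
      obtain ⟨f, -⟩ := hroot p x hx
      have := one_le_idealCount (K := K) (n := p ^ j) (RingHom.ker f ^ j)
        (by rw [map_pow, absNorm_ker_ringHom_zmod])
      rw [h, Finset.sum_range_succ']
      simpa using this
    · obtain ⟨x, y, hxy, hx, hy⟩ := hroot1 p h
      obtain ⟨f, hf⟩ := hroot p x hx
      obtain ⟨g, hg⟩ := hroot p y hy
      have hker : RingHom.ker f ≠ RingHom.ker g := by
        intro he
        have h1 : ω - ((x.val : ℕ) : 𝓞 K) ∈ RingHom.ker f := by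
          rw [RingHom.mem_ker, map_sub, map_natCast, ZMod.natCast_zmod_val, hf, sub_self]
        rw [he, RingHom.mem_ker, map_sub, map_natCast, ZMod.natCast_zmod_val, hg, sub_eq_zero] at h1
        exact hxy h1.symm
      have := succ_le_idealCount_pow f g hker j
      rw [h]
      simp only [one_pow, Finset.sum_const, Finset.card_range, nsmul_eq_mul, mul_one]
      rw [Complex.natCast_re]
      exact_mod_cast this
    · rw [h, neg_one_geom_sum]
      split_ifs with he
      · simp
      · have hj2 : Even j := by rw [Nat.even_add_one] at he; exact not_not.1 he
        obtain ⟨i, rfl⟩ := hj2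
        have := one_le_idealCount (K := K) (n := p ^ (i + i)) (Ideal.span {((p ^ i : ℕ) : 𝓞 K)})
          (by rw [Ideal.absNorm_span_natCast, RingOfIntegers.rank, hK]; ring)
        simpa using this
  | coprime a b ha hb hab iha ihb =>
    have hreal (n : ℕ) : χ.zetaMul n = ((χ.zetaMul n).re : ℂ) := by
      have h0 := Complex.nonneg_iff.1 (DirichletCharacter.zetaMul_nonneg hsq n)
      exact Complex.ext rfl (by simpa using h0.2.symm)
    have hnn (n : ℕ) : 0 ≤ (χ.zetaMul n).re :=
      (Complex.nonneg_iff.1 (DirichletCharacter.zetaMul_nonneg hsq n)).1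
    rw [(χ.isMultiplicative_zetaMul).map_mul_of_coprime hab, hreal a, hreal b, ← Complex.ofReal_mul,
      Complex.ofReal_re]
    calc _ ≤ (idealCount K a : ℝ) * idealCount K b :=
          mul_le_mul (iha (by omega)) (ihb (by omega)) (hnn b) (by positivity)
      _ ≤ _ := by exact_mod_cast idealCount_mul_le hab

end Count

theorem IsKroneckerChar.ne_one {D : ℤ} {χ : DirichletCharacter ℂ D.natAbs}
    (hχ : IsKroneckerChar D χ) (hD : D < 0) (h4 : D % 4 = 0 ∨ D % 4 = 1) : χ ≠ 1 := by
  suffices h : ∃ m : ℕ, Odd m ∧ m.Coprime D.natAbs ∧ jacobiSym D m = -1 by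
    obtain ⟨m, hm, hcop, hj⟩ := h
    rintro rfl
    have h1 := hχ.eq_jacobiSym hm hcop
    rw [hj, MulChar.one_apply ((ZMod.isUnit_iff_coprime _ _).2 hcop)] at h1
    norm_num at h1
  obtain ⟨k, hk⟩ : ∃ k : ℕ, D = -k := ⟨D.natAbs, by omega⟩
  subst hk
  have hk0 : 0 < k := by omega
  simp only [Int.natAbs_neg, Int.natAbs_natCast]
  rcases h4 with h4 | h4
  · have ho : Odd (k - 1) := by rw [Nat.odd_iff]; omega
    refine ⟨k - 1, ho, ?_, ?_⟩
    · have h := Nat.coprime_self_add_right (m := k - 1) (n := 1)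
      rw [show k - 1 + 1 = k by omega] at h
      exact h.2 (Nat.coprime_one_right _)
    · rw [jacobiSym.mod_left,
        show (-(k : ℤ)) % ((k - 1 : ℕ) : ℤ) = (-1) % ((k - 1 : ℕ) : ℤ) from ?_,
        ← jacobiSym.mod_left, jacobiSym.at_neg_one ho, ZMod.χ₄_nat_three_mod_four (by omega)]
      apply Int.ModEq.symm
      rw [Int.modEq_iff_dvd]
      exact ⟨-1, by omega⟩
  · have ho : Odd (2 * k - 1) := by rw [Nat.odd_iff]; omega
    have hcop : (2 * k - 1).Coprime k := by
      have h := Nat.coprime_self_add_right (m := 2 * k - 1) (n := 1)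
      rw [show 2 * k - 1 + 1 = 2 * k by omega] at h
      exact Nat.Coprime.coprime_mul_left_right (h.2 (Nat.coprime_one_right _))
    refine ⟨2 * k - 1, ho, hcop, ?_⟩
    have e2 : jacobiSym 2 (2 * k - 1) = -1 := by
      rw [jacobiSym.at_two ho, ZMod.χ₈_nat_eq_if_mod_eight, if_neg (by omega), if_neg (by omega)]
    have e1 : jacobiSym (2 * -(k : ℤ)) (2 * k - 1) = 1 := by
      rw [jacobiSym.mod_left, show (2 * -(k : ℤ)) % ((2 * k - 1 : ℕ) : ℤ)
        = (-1) % ((2 * k - 1 : ℕ) : ℤ) from ?_,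
        ← jacobiSym.mod_left, jacobiSym.at_neg_one ho, ZMod.χ₄_nat_one_mod_four (by omega)]
      apply Int.ModEq.symm
      rw [Int.modEq_iff_dvd]
      exact ⟨-1, by omega⟩
    rw [jacobiSym.mul_left, e2] at e1
    omega

theorem IsFundamentalDiscriminant.emod_four {D : ℤ} (h : IsFundamentalDiscriminant D) :
    D % 4 = 0 ∨ D % 4 = 1 := by
  rcases h.2 with h | ⟨m, h, -⟩
  · exact Or.inr h.1
  · omega

section Residue
variable {K : Type*} [Field K] [NumberField K]

open Real in
theorem dedekindZeta_residue_le (hK : Module.finrank ℚ K = 2) (hD : discr K < 0) :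
    dedekindZeta_residue K ≤ π * classNumber K / √|(discr K : ℝ)| := by
  have hsign := sign_discr K
  rw [Int.sign_eq_neg_one_of_neg hD] at hsign
  have hcard := InfinitePlace.card_add_two_mul_card_eq_rank K
  rw [hK] at hcard
  have hc : InfinitePlace.nrComplexPlaces K = 1 := by
    have : InfinitePlace.nrComplexPlaces K ≠ 0 := by
      intro h; rw [h] at hsign; norm_num at hsign
    omega
  have hr : InfinitePlace.nrRealPlaces K = 0 := by omega
  have hrank : Units.rank K = 0 := by
    rw [Units.rank, InfinitePlace.card_eq_nrRealPlaces_add_nrComplexPlaces, hc, hr]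
  have hreg : Units.regulator K = 1 := by
    have : IsEmpty (Fin (Units.rank K)) := by rw [hrank]; infer_instance
    have := (Units.equivFinRank K).symm.isEmpty
    rw [Units.regulator_eq_det']
    classical
    simp only [Matrix.det_isEmpty, abs_one]
  have htors : (2 : ℝ) ≤ Units.torsionOrder K := by
    have : 1 < Nat.card (Units.torsion K) := by
      rw [Finite.one_lt_card_iff_nontrivial]
      refine ⟨⟨1, ⟨⟨-1, ?_⟩, ?_⟩⟩⟩
      · rw [Units.torsion, CommGroup.mem_torsion]
        exact isOfFinOrder_iff_pow_eq_one.2 ⟨2, by norm_num, by simp⟩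
      · intro h
        have h' := congrArg (fun u : Units.torsion K ↦ ((u : (𝓞 K)ˣ) : 𝓞 K)) h
        simp only [OneMemClass.coe_one, Units.val_one, Units.val_neg] at h'
        have h2 : (2 : 𝓞 K) = 0 := by linear_combination h'
        exact two_ne_zero h2
    exact_mod_cast this
  have hs : 0 < √|(discr K : ℝ)| :=
    sqrt_pos.2 (abs_pos.2 (by exact_mod_cast hD.ne))
  rw [dedekindZeta_residue_def, hc, hr, hreg]
  calc _ ≤ (2 ^ 0 * (2 * π) ^ 1 * 1 * classNumber K) / (2 * √|(discr K : ℝ)|) := by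
        gcongr
    _ = _ := by field_simp

open Filter Topology in
theorem LSeriesSummable_idealCount {s : ℂ} (hs : 1 < s.re) :
    LSeriesSummable (fun n ↦ (idealCount K n : ℂ)) s := by
  have key : Tendsto (fun n : ℕ ↦ (∑ k ∈ Finset.Icc 1 n, (idealCount K k : ℝ)) / n) atTop
      (𝓝 (dedekindZeta_residue K)) := by
    refine ((Ideal.tendsto_norm_le_div_atTop₀ K).comp tendsto_natCast_atTop_atTop).congr
      fun n ↦ ?_
    simp only [Function.comp_apply, Nat.cast_le, ← Nat.cast_sum, idealCount]
    congr
    rw [← add_left_inj 1, ← Ideal.card_norm_le_eq_card_norm_le_add_one,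
      show Finset.Icc 1 n = Finset.Ioc 0 n from Finset.Icc_succ_left_eq_Ioc _ _,
      show 1 = Nat.card {I : Ideal (𝓞 K) // Ideal.absNorm I = 0} by
        simp [Ideal.absNorm_eq_zero_iff],
      Finset.sum_Ioc_add_eq_sum_Icc (n.zero_le),
      ← Finset.card_preimage_eq_sum_card_image_eq
        (fun k _ ↦ Ideal.finite_setOfPred_absNorm_eq k)]
    simp [Set.coe_eq_subtype]
  exact_mod_cast LSeriesSummable_of_sum_norm_bigO_and_nonneg (r := 1)
    (Asymptotics.isBigO_atTop_natCast_rpow_of_tendsto_div_rpow (by simpa))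
    (fun _ ↦ Nat.cast_nonneg _)
    zero_le_one hs

open Filter Topology in
theorem re_le_dedekindZeta_residue (hK : Module.finrank ℚ K = 2) {D : ℤ} (hD : D < 0)
    (hdisc : discr K = D) {χ : DirichletCharacter ℂ D.natAbs} (hχ : IsKroneckerChar D χ) {c : ℂ}
    (hc : Tendsto (fun s : ℝ ↦ ((s : ℂ) - 1) * LSeries χ.zetaMul s) (𝓝[>] 1) (𝓝 c)) :
    c.re ≤ dedekindZeta_residue K := by
  have h1 := (Complex.continuous_re.tendsto _).comp hc
  have h3 := tendsto_sub_one_mul_dedekindZeta_nhdsGT K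
  have h3' := (Complex.continuous_re.tendsto _).comp h3
  rw [Complex.ofReal_re] at h3'
  refine le_of_tendsto_of_tendsto h1 h3' ?_
  filter_upwards [self_mem_nhdsWithin] with s (hs : 1 < s)
  have hs' : 1 < (s : ℂ).re := hs
  have e : ((s : ℂ) - 1) = ((s - 1 : ℝ) : ℂ) := by push_cast; rfl
  simp only [Function.comp_apply, e, Complex.re_ofReal_mul]
  refine mul_le_mul_of_nonneg_left ?_ (by linarith)
  change _ ≤ (LSeries (fun n ↦ (idealCount K n : ℂ)) s).re
  rw [LSeries, LSeries, Complex.re_tsum (χ.LSeriesSummable_zetaMul hs'),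
    Complex.re_tsum (LSeriesSummable_idealCount hs')]
  refine Summable.tsum_le_tsum (fun n ↦ ?_) (Complex.reCLM.summable (χ.LSeriesSummable_zetaMul hs'))
    (Complex.reCLM.summable (LSeriesSummable_idealCount hs'))
  rcases eq_or_ne n 0 with rfl | hn
  · simp
  rw [LSeries.term_of_ne_zero hn, LSeries.term_of_ne_zero hn]
  have e2 : (n : ℂ) ^ (s : ℂ) = (((n : ℝ) ^ s : ℝ) : ℂ) := by
    rw [Complex.ofReal_cpow (Nat.cast_nonneg n), Complex.ofReal_natCast]
  rw [e2, Complex.div_ofReal_re, Complex.div_ofReal_re, Complex.natCast_re]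
  gcongr
  exact zetaMul_re_le_idealCount hK hD hdisc hχ n hn

end Residue

section Mellin

open Filter Topology Set Complex MeasureTheory

theorem hasMellin_inv_Ioc {δ : ℝ} (hδ : 0 < δ) {s : ℂ} (hs : 1 < s.re) :
    HasMellin (indicator (Ioc 0 δ) (fun t : ℝ ↦ (t : ℂ)⁻¹)) s ((δ : ℂ) ^ (s - 1) / (s - 1)) := by
  have h := hasMellin_cpow_Ioc (-1) (s := s) (by simpa using hs)
  have hδ' : (δ : ℂ) ≠ 0 := ofReal_ne_zero.2 hδ.ne'
  have e : (indicator (Ioc 0 δ) (fun t : ℝ ↦ (t : ℂ)⁻¹)) = fun t ↦ (δ : ℂ)⁻¹ •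
      (fun t : ℝ ↦ indicator (Ioc 0 1) (fun t : ℝ ↦ (t : ℂ) ^ (-1 : ℂ)) (δ⁻¹ * t)) t := by
    ext t
    have : δ⁻¹ * t ∈ Ioc (0 : ℝ) 1 ↔ t ∈ Ioc 0 δ := by
      simp only [mem_Ioc, inv_mul_le_one₀ hδ]
      rw [mul_pos_iff_of_pos_left (inv_pos.2 hδ)]
    by_cases ht : t ∈ Ioc 0 δ
    · rw [indicator_of_mem ht]
      simp only [indicator_of_mem (this.2 ht), cpow_neg_one, smul_eq_mul, ofReal_mul, ofReal_inv]
      field_simp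
    · rw [indicator_of_notMem ht]
      simp only [indicator_of_notMem (mt this.1 ht), smul_zero]
  have h1 : HasMellin
      (fun t : ℝ ↦ indicator (Ioc 0 1) (fun t : ℝ ↦ (t : ℂ) ^ (-1 : ℂ)) (δ⁻¹ * t)) s
      (((δ⁻¹ : ℝ) : ℂ) ^ (-s) • (1 / (s + -1))) :=
    ⟨(MellinConvergent.comp_mul_left (inv_pos.2 hδ)).2 h.1,
      by rw [mellin_comp_mul_left _ _ (inv_pos.2 hδ), h.2]⟩
  have h2 := hasMellin_const_smul h1.1 ((δ : ℂ)⁻¹)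
  rw [e]
  convert h2 using 1
  rw [h1.2, ofReal_inv, inv_cpow _ _ (by rw [arg_ofReal_of_nonneg hδ.le]; exact Real.pi_pos.ne),
    cpow_neg, inv_inv, cpow_sub _ _ hδ', cpow_one, smul_eq_mul, smul_eq_mul]
  ring

/-- The exponential generating series attached to `a`, minus its polar part `c / t` on
`(0, δ]`. -/
noncomputable def truncatedTheta (F : ℝ → ℂ) (c : ℂ) (δ : ℝ) (t : ℝ) : ℂ :=
  F t - c * indicator (Ioc 0 δ) (fun t : ℝ ↦ (t : ℂ)⁻¹) t

variable {a : ℕ → ℂ} {F : ℝ → ℂ} {c : ℂ} {B δ : ℝ}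

theorem continuousOn_of_hasSum_exp
    (hF : ∀ t : ℝ, 0 < t → HasSum (fun n : ℕ ↦ a n * Real.exp (-n * t)) (F t)) :
    ContinuousOn F (Ioi 0) := by
  intro t (ht : 0 < t)
  refine ContinuousAt.continuousWithinAt ?_
  have h : ContinuousOn (fun t : ℝ ↦ ∑' n : ℕ, a n * Real.exp (-n * t)) (Ioi (t / 2)) := by
    refine continuousOn_tsum (u := fun n : ℕ ↦ ‖a n * Real.exp (-n * (t / 2))‖)
      (fun n ↦ ?_) (hF (t / 2) (by positivity)).summable.norm fun n x (hx : t / 2 < x) ↦ ?_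
    · fun_prop
    · rw [norm_mul, norm_mul, norm_real, norm_real, Real.norm_eq_abs, Real.norm_eq_abs,
        Real.abs_exp, Real.abs_exp]
      gcongr ?_ * Real.exp ?_
      nlinarith [(Nat.cast_nonneg n : (0 : ℝ) ≤ n)]
  refine (h.continuousAt (Ioi_mem_nhds (by linarith))).congr ?_
  filter_upwards [Ioi_mem_nhds ht] with x hx using (hF x hx).tsum_eq

theorem isBigO_atTop_of_hasSum_exp (ha : a 0 = 0)
    (hF : ∀ t : ℝ, 0 < t → HasSum (fun n : ℕ ↦ a n * Real.exp (-n * t)) (F t)) :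
    F =O[atTop] fun t ↦ Real.exp (-1 * t) := by
  have h1 := (hF 1 one_pos).summable.norm
  refine Asymptotics.IsBigO.of_bound ((∑' n : ℕ, ‖a n * Real.exp (-n * 1)‖) * Real.exp 1) ?_
  filter_upwards [eventually_ge_atTop 1] with t ht
  rw [← (hF t (by linarith)).tsum_eq, Real.norm_eq_abs, Real.abs_exp, mul_assoc, ← Real.exp_add,
    ← tsum_mul_right]
  refine tsum_of_norm_bounded (h1.mul_right _).hasSum fun n ↦ ?_
  rcases eq_or_ne n 0 with rfl | hn
  · simp [ha]
  have hn' : (1 : ℝ) ≤ n := by exact_mod_cast Nat.one_le_iff_ne_zero.2 hn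
  rw [norm_mul, norm_mul, norm_real, norm_real, Real.norm_eq_abs, Real.norm_eq_abs,
        Real.abs_exp, Real.abs_exp, mul_assoc, ← Real.exp_add]
  gcongr ?_ * Real.exp ?_
  nlinarith

section

variable (ha : a 0 = 0)
    (hF : ∀ t : ℝ, 0 < t → HasSum (fun n : ℕ ↦ a n * Real.exp (-n * t)) (F t))
    (hB : ∀ t : ℝ, 0 < t → t ≤ 1 → ‖F t - c / t‖ ≤ B) (hδ : 0 < δ)

include hF in
theorem locallyIntegrableOn_truncatedTheta :
    LocallyIntegrableOn (truncatedTheta F c δ) (Ioi 0) := by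
  refine LocallyIntegrableOn.sub
    ((continuousOn_of_hasSum_exp hF).locallyIntegrableOn measurableSet_Ioi) ?_
  have h : LocallyIntegrableOn (fun t : ℝ ↦ c * (t : ℂ)⁻¹) (Ioi 0) := by
    refine ContinuousOn.locallyIntegrableOn ?_ measurableSet_Ioi
    refine continuousOn_const.mul (ContinuousOn.inv₀ (by fun_prop) fun x (hx : 0 < x) ↦ ?_)
    exact ofReal_ne_zero.2 hx.ne'
  rw [locallyIntegrableOn_iff isOpen_Ioi.isLocallyClosed] at h ⊢
  intro k hk hk'
  have := (h k hk hk').indicator (t := Ioc 0 δ) measurableSet_Ioc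
  refine this.congr (ae_of_all _ fun t ↦ ?_)
  by_cases ht : t ∈ Ioc 0 δ <;> simp [ht]

include ha hF in
theorem isBigO_atTop_truncatedTheta :
    truncatedTheta F c δ =O[atTop] fun t ↦ Real.exp (-1 * t) := by
  refine (isBigO_atTop_of_hasSum_exp ha hF).congr' ?_ EventuallyEq.rfl
  filter_upwards [eventually_gt_atTop δ] with t ht
  simp [truncatedTheta, ht.not_ge]

include hB hδ in
theorem isBigO_zero_truncatedTheta :
    truncatedTheta F c δ =O[𝓝[>] 0] (· ^ (-(0 : ℝ))) := by
  refine Asymptotics.IsBigO.of_bound B ?_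
  filter_upwards [Ioo_mem_nhdsGT (show (0 : ℝ) < min δ 1 by positivity)] with t ht
  have h1 : t ∈ Ioc 0 δ := ⟨ht.1, (ht.2.trans_le (min_le_left _ _)).le⟩
  simpa [truncatedTheta, h1, div_eq_mul_inv] using
    hB t ht.1 (ht.2.trans_le (min_le_right _ _)).le

include ha hF hB hδ in
theorem mellinConvergent_truncatedTheta {s : ℂ} (hs : 0 < s.re) :
    MellinConvergent (truncatedTheta F c δ) s :=
  mellinConvergent_of_isBigO_rpow_exp one_pos (locallyIntegrableOn_truncatedTheta hF)
    (isBigO_atTop_truncatedTheta ha hF) (isBigO_zero_truncatedTheta hB hδ) hs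

include ha hF hB hδ in
theorem Gamma_mul_eq_mellin_truncatedTheta
    (hsum : ∀ s : ℂ, 1 < s.re → LSeriesSummable a s) {H : ℂ → ℂ} (hH : Differentiable ℂ H)
    (hHa : ∀ s : ℂ, 1 < s.re → H s = (s - 1) * LSeries a s) {s : ℂ} (hs : 0 < s.re) :
    Complex.Gamma s * H s = (s - 1) * mellin (truncatedTheta F c δ) s + c * (δ : ℂ) ^ (s - 1) := by
  have hopen : IsOpen {s : ℂ | 0 < s.re} := isOpen_lt continuous_const continuous_re
  have hl : AnalyticOnNhd ℂ (fun s ↦ Complex.Gamma s * H s) {s : ℂ | 0 < s.re} := by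
    refine DifferentiableOn.analyticOnNhd (fun z (hz : 0 < z.re) ↦ ?_) hopen
    refine ((differentiableAt_Gamma z fun m h ↦ ?_).mul (hH z)).differentiableWithinAt
    rw [h] at hz
    simp at hz
    linarith [(Nat.cast_nonneg m : (0 : ℝ) ≤ m)]
  have hδ' : (δ : ℂ) ≠ 0 := ofReal_ne_zero.2 hδ.ne'
  have hr : AnalyticOnNhd ℂ
      (fun s ↦ (s - 1) * mellin (truncatedTheta F c δ) s + c * (δ : ℂ) ^ (s - 1))
      {s : ℂ | 0 < s.re} := by
    refine DifferentiableOn.analyticOnNhd (fun z (hz : 0 < z.re) ↦ ?_) hopen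
    have h1 : DifferentiableAt ℂ (mellin (truncatedTheta F c δ)) z :=
      mellin_differentiableAt_of_isBigO_rpow_exp one_pos (locallyIntegrableOn_truncatedTheta hF)
        (isBigO_atTop_truncatedTheta ha hF) (isBigO_zero_truncatedTheta hB hδ) hz
    have h2 : DifferentiableAt ℂ (fun s : ℂ ↦ (δ : ℂ) ^ (s - 1)) z :=
      DifferentiableAt.const_cpow (by fun_prop) (Or.inl hδ')
    exact (((by fun_prop : DifferentiableAt ℂ (fun s : ℂ ↦ s - 1) z).mul h1).add
      (h2.const_mul c)).differentiableWithinAt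
  have hconv : Convex ℝ {s : ℂ | 0 < s.re} := convex_halfSpace_re_gt 0
  refine hl.eqOn_of_preconnected_of_eventuallyEq hr hconv.isPreconnected (z₀ := 2) (by simp) ?_ hs
  have h2 : {s : ℂ | 1 < s.re} ∈ 𝓝 (2 : ℂ) :=
    (isOpen_lt continuous_const continuous_re).mem_nhds (by simp)
  filter_upwards [h2] with s (hs : 1 < s.re)
  have hs0 : 0 < s.re := one_pos.trans hs
  have hs1 : s - 1 ≠ 0 := fun h ↦ by
    rw [sub_eq_zero] at h
    simp [h] at hs
  have hM := mellinConvergent_truncatedTheta (s := s) ha hF hB hδ hs0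
  have hI := hasMellin_inv_Ioc hδ hs
  have hIc := hasMellin_const_smul hI.1 c
  have hadd := hasMellin_add hM hIc.1
  have e : (fun t ↦ truncatedTheta F c δ t +
      c • (indicator (Ioc 0 δ) fun t : ℝ ↦ (t : ℂ)⁻¹) t) = F := by
    ext t
    simp [truncatedTheta]
  rw [e] at hadd
  have hL : HasSum (fun n : ℕ ↦ Complex.Gamma s * a n / ((n : ℝ) : ℂ) ^ s) (mellin F s) := by
    refine hasSum_mellin (fun n ↦ ?_) hs0 (fun t ht ↦ hF t ht) ?_
    · rcases Nat.eq_zero_or_pos n with rfl | hn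
      · exact Or.inl ha
      · exact Or.inr (by exact_mod_cast hn)
    · refine (hsum s hs).norm.congr fun n ↦ ?_
      rcases eq_or_ne n 0 with rfl | hn
      · simp [ha]
      · rw [LSeries.term_of_ne_zero hn, norm_div, norm_natCast_cpow_of_pos (Nat.pos_of_ne_zero hn)]
  have hL2 : Complex.Gamma s * LSeries a s = mellin F s := by
    rw [← hL.tsum_eq, LSeries, ← tsum_mul_left]
    congr 1
    ext n
    rcases eq_or_ne n 0 with rfl | hn
    · simp [ha]
    · rw [LSeries.term_of_ne_zero hn, ofReal_natCast, mul_div_assoc]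
  rw [hHa s hs, mul_left_comm, hL2, hadd.2, hIc.2, hI.2, smul_eq_mul]
  field_simp

end

theorem Gamma_mul_eq_integral {a : ℕ → ℝ} {F : ℝ → ℝ} {c B δ : ℝ} (ha : a 0 = 0)
    (hF : ∀ t : ℝ, 0 < t → HasSum (fun n : ℕ ↦ a n * Real.exp (-n * t)) (F t))
    (hB : ∀ t : ℝ, 0 < t → t ≤ 1 → |F t - c / t| ≤ B) (hδ : 0 < δ)
    (hsum : ∀ s : ℂ, 1 < s.re → LSeriesSummable (fun n ↦ (a n : ℂ)) s) {H : ℂ → ℂ}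
    (hH : Differentiable ℂ H)
    (hHa : ∀ s : ℂ, 1 < s.re → H s = (s - 1) * LSeries (fun n ↦ (a n : ℂ)) s)
    {s : ℝ} (hs : 0 < s) :
    IntegrableOn (fun t : ℝ ↦ t ^ (s - 1) * (F t - c * indicator (Ioc 0 δ) (·⁻¹) t)) (Ioi 0) ∧
    Real.Gamma s * H s =
      ((s - 1) * (∫ t in Ioi 0, t ^ (s - 1) * (F t - c * indicator (Ioc 0 δ) (·⁻¹) t)) +
        c * δ ^ (s - 1) : ℝ) := by
  have ha' : (a 0 : ℂ) = 0 := by rw [ha, ofReal_zero]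
  have hF' : ∀ t : ℝ, 0 < t →
      HasSum (fun n : ℕ ↦ (a n : ℂ) * Real.exp (-n * t)) (F t : ℂ) := fun t ht ↦ by
    exact_mod_cast (hasSum_ofReal.2 (hF t ht) :)
  have hB' : ∀ t : ℝ, 0 < t → t ≤ 1 → ‖(F t : ℂ) - c / t‖ ≤ B := fun t ht ht1 ↦ by
    rw [← ofReal_div, ← ofReal_sub, norm_real]
    exact hB t ht ht1
  have hs' : 0 < (s : ℂ).re := hs
  have h1 := mellinConvergent_truncatedTheta (c := (c : ℂ)) ha' hF' hB' hδ hs'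
  have h2 := Gamma_mul_eq_mellin_truncatedTheta (c := (c : ℂ)) ha' hF' hB' hδ hsum hH hHa hs'
  have e : ∀ t ∈ Ioi (0 : ℝ), (t : ℂ) ^ ((s : ℂ) - 1) •
      truncatedTheta (fun t ↦ (F t : ℂ)) c δ t =
      ((t ^ (s - 1) * (F t - c * indicator (Ioc 0 δ) (·⁻¹) t) : ℝ) : ℂ) := fun t ht ↦ by
    rw [truncatedTheta, smul_eq_mul, ofReal_mul, ofReal_cpow (le_of_lt ht)]
    by_cases h : t ∈ Ioc 0 δ <;> simp [h]
  rw [mellin, setIntegral_congr_fun measurableSet_Ioi e, integral_complex_ofReal] at h2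
  refine ⟨?_, ?_⟩
  · have h3 := h1
    rw [MellinConvergent] at h3
    rw [integrableOn_congr_fun e measurableSet_Ioi] at h3
    exact h3.re
  · rw [← Complex.Gamma_ofReal, h2, ofReal_add, ofReal_mul, ofReal_mul, ofReal_cpow hδ.le]
    simp

theorem hasSum_exp_neg_mul {t : ℝ} (ht : 0 < t) :
    HasSum (fun n : ℕ ↦ (if n = 0 then 0 else 1) * Real.exp (-n * t)) (1 / (Real.exp t - 1)) := by
  have h := (hasSum_geometric_of_lt_one (Real.exp_pos (-t)).le
    (Real.exp_lt_one_iff.2 (neg_neg_of_pos ht))).mul_left (Real.exp (-t))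
  have h1 := Real.exp_pos t
  have h2 : Real.exp t - 1 ≠ 0 := (sub_pos.2 (Real.one_lt_exp_iff.2 ht)).ne'
  have e : 1 / (Real.exp t - 1) = Real.exp (-t) * (1 - Real.exp (-t))⁻¹ := by
    rw [Real.exp_neg, ← mul_inv, mul_sub, mul_one, mul_inv_cancel₀ h1.ne', one_div]
  rw [e]
  refine (hasSum_nat_add_iff' 1).1 ?_
  simp only [Finset.range_one, Finset.sum_singleton, if_true, zero_mul, sub_zero]
  refine h.congr_fun fun n ↦ ?_
  rw [if_neg n.succ_ne_zero, one_mul, ← Real.exp_nat_mul, ← Real.exp_add]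
  congr 1
  push_cast
  ring

theorem one_div_exp_sub_one_le {t : ℝ} (ht : 0 < t) : 1 / (Real.exp t - 1) ≤ 1 / t :=
  one_div_le_one_div_of_le ht (by linarith [Real.add_one_le_exp t])

theorem one_div_le_one_div_exp_sub_one_add {t : ℝ} (ht : 0 < t) :
    1 / t ≤ 1 / (Real.exp t - 1) + 1 := by
  have h1 : 0 < Real.exp t - 1 := sub_pos.2 (Real.one_lt_exp_iff.2 ht)
  have h2 := Real.add_one_le_exp (-t)
  rw [Real.exp_neg] at h2
  have h3 := Real.exp_pos t
  rw [div_add_one h1.ne', div_le_div_iff₀ ht h1]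
  have h4 : (-t + 1) * Real.exp t ≤ 1 := by
    calc _ ≤ (Real.exp t)⁻¹ * Real.exp t := by gcongr
      _ = 1 := inv_mul_cancel₀ h3.ne'
  nlinarith

theorem antitoneOn_one_div_sub_one_div_exp_sub_one :
    AntitoneOn (fun t : ℝ ↦ 1 / t - 1 / (Real.exp t - 1)) (Ioi 0) := by
  have hd : ∀ t : ℝ, 0 < t → HasDerivAt (fun t : ℝ ↦ 1 / t - 1 / (Real.exp t - 1))
      (-1 / t ^ 2 - (-Real.exp t) / (Real.exp t - 1) ^ 2) t := fun t ht ↦ by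
    have h1 : Real.exp t - 1 ≠ 0 := (sub_pos.2 (Real.one_lt_exp_iff.2 ht)).ne'
    simp only [one_div]
    exact ((hasDerivAt_id t).fun_inv ht.ne').sub (((Real.hasDerivAt_exp t).sub_const 1).fun_inv h1)
  refine antitoneOn_of_deriv_nonpos (convex_Ioi 0)
    (fun t ht ↦ (hd t ht).continuousAt.continuousWithinAt)
    (fun t ht ↦ (hd t (by simpa using ht)).differentiableAt.differentiableWithinAt) fun t ht ↦ ?_
  rw [interior_Ioi, mem_Ioi] at ht
  rw [(hd t ht).deriv]
  have h1 : 0 < Real.exp t - 1 := sub_pos.2 (Real.one_lt_exp_iff.2 ht)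
  have h2 := Real.self_le_sinh_iff.2 (by positivity : 0 ≤ t / 2)
  rw [Real.sinh_eq] at h2
  have e : Real.exp t = Real.exp (t / 2) ^ 2 := by rw [← Real.exp_nat_mul]; congr 1; push_cast; ring
  have e2 : Real.exp (-(t / 2)) * Real.exp (t / 2) = 1 := by rw [← Real.exp_add]; simp
  have h3 : t * Real.exp (t / 2) ≤ Real.exp t - 1 := by
    have := mul_le_mul_of_nonneg_right h2 (Real.exp_pos (t / 2)).le
    nlinarith
  have h4 : t ^ 2 * Real.exp t ≤ (Real.exp t - 1) ^ 2 := by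
    calc t ^ 2 * Real.exp t = (t * Real.exp (t / 2)) ^ 2 := by rw [mul_pow, ← e]
      _ ≤ _ := by gcongr
  have h5 : Real.exp t / (Real.exp t - 1) ^ 2 ≤ 1 / t ^ 2 := by
    rw [div_le_div_iff₀ (by positivity) (by positivity)]
    linarith
  rw [neg_div, neg_div]
  linarith

theorem LFunctionTrivChar₁_one_apply_one : DirichletCharacter.LFunctionTrivChar₁ 1 1 = 1 := by
  simp

theorem LFunctionTrivChar₁_one_apply {s : ℂ} (hs : s ≠ 1) :
    DirichletCharacter.LFunctionTrivChar₁ 1 s = (s - 1) * riemannZeta s := by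
  rw [DirichletCharacter.LFunctionTrivChar₁, Function.update_of_ne hs,
    DirichletCharacter.LFunctionTrivChar, DirichletCharacter.LFunction_modOne_eq]

theorem exists_riemannZeta_eq_neg {s : ℝ} (hs : 1 / 2 < s) (hs1 : s < 1) :
    ∃ z : ℝ, z < 0 ∧ riemannZeta s = z := by
  have hζ : (fun n : ℕ ↦ ((if n = 0 then 0 else 1 : ℝ) : ℂ)) =
      fun n ↦ ((ArithmeticFunction.zeta n : ℕ) : ℂ) := by
    ext n
    simp only [ArithmeticFunction.zeta_apply]
    split_ifs <;> simp
  obtain ⟨h1, h2⟩ := Gamma_mul_eq_integral (c := 1) (B := 1) (δ := 1) (if_pos rfl)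
    (fun t ht ↦ hasSum_exp_neg_mul ht) (fun t ht _ ↦ by
      rw [abs_le]
      constructor <;> linarith [one_div_exp_sub_one_le ht, one_div_le_one_div_exp_sub_one_add ht])
    one_pos (fun s hs ↦ by
      rw [hζ]
      exact ArithmeticFunction.LSeriesSummable_zeta_iff.2 hs)
    (DirichletCharacter.differentiable_LFunctionTrivChar₁ 1) (fun s hs ↦ by
      rw [hζ, ArithmeticFunction.LSeries_zeta_eq_riemannZeta hs, LFunctionTrivChar₁_one_apply]
      rintro rfl
      simp at hs) (by linarith : 0 < s)
  have hI : (∫ t in Ioi (0 : ℝ), t ^ (s - 1) *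
      (1 / (Real.exp t - 1) - 1 * indicator (Ioc 0 1) (·⁻¹) t)) ≤ 2 := by
    calc _ ≤ ∫ t in Ioi (0 : ℝ), 2 * Real.exp (-t) := by
          refine setIntegral_mono_on h1 ((integrableOn_exp_neg_Ioi 0).const_mul 2)
            measurableSet_Ioi fun t (ht : 0 < t) ↦ ?_
          rcases le_or_gt t 1 with h | h
          · rw [indicator_of_mem (show t ∈ Ioc 0 1 from ⟨ht, h⟩)]
            have := one_div_exp_sub_one_le ht
            rw [one_div t] at this
            exact (mul_nonpos_of_nonneg_of_nonpos (by positivity) (by linarith)).trans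
              (by positivity)
          · rw [indicator_of_notMem (fun h' ↦ h.not_ge h'.2), mul_zero, sub_zero]
            have h3 := Real.add_one_le_exp t
            have h4 : 1 / (Real.exp t - 1) ≤ 2 * Real.exp (-t) := by
              rw [Real.exp_neg, ← div_eq_mul_inv, div_le_div_iff₀ (by linarith) (by linarith)]
              linarith
            calc _ ≤ 1 * (2 * Real.exp (-t)) := by
                  refine mul_le_mul (Real.rpow_le_one_of_one_le_of_nonpos h.le (by linarith)) h4
                    (one_div_nonneg.2 (by linarith)) zero_le_one
              _ = _ := one_mul _
      _ = 2 := by rw [integral_const_mul, integral_exp_neg_Ioi_zero, mul_one]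
  set I := ∫ t in Ioi (0 : ℝ), t ^ (s - 1) *
      (1 / (Real.exp t - 1) - 1 * indicator (Ioc 0 1) (·⁻¹) t)
  have hG : 0 < Real.Gamma s := Real.Gamma_pos_of_pos (by linarith)
  have hsne : (s : ℂ) ≠ 1 := by exact_mod_cast hs1.ne
  rw [LFunctionTrivChar₁_one_apply hsne, Real.one_rpow, mul_one] at h2
  refine ⟨((s - 1) * I + 1) / (Real.Gamma s * (s - 1)), ?_, ?_⟩
  · refine div_neg_of_pos_of_neg ?_ (mul_neg_of_pos_of_neg hG (by linarith))
    nlinarith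
  · have h3 : (s : ℂ) - 1 ≠ 0 := sub_ne_zero.2 hsne
    have h4 : (Real.Gamma s : ℂ) ≠ 0 := ofReal_ne_zero.2 hG.ne'
    rw [ofReal_div, ← h2]
    push_cast
    field_simp

end Mellin

section Lambert
open Filter Topology Set

theorem abs_sum_mul_le_of_antitone {f v : ℕ → ℝ} (hf : Antitone f) (hf0 : ∀ n, 0 ≤ f n) {B : ℝ}
    (hv : ∀ n, |∑ i ∈ Finset.range n, v i| ≤ B) (n : ℕ) :
    |∑ i ∈ Finset.range n, f i * v i| ≤ B * f 0 := by
  have h : ∀ n, ∑ i ∈ Finset.range n, f i * v i = f n * ∑ i ∈ Finset.range n, v i +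
      ∑ i ∈ Finset.range n, (f i - f (i + 1)) * ∑ j ∈ Finset.range (i + 1), v j := fun n ↦ by
    induction n with
    | zero => simp
    | succ n ih =>
      rw [Finset.sum_range_succ, ih, Finset.sum_range_succ (fun i ↦ (f i - f (i + 1)) * _),
        Finset.sum_range_succ v]
      ring
  rw [h n]
  calc _ ≤ f n * B + ∑ i ∈ Finset.range n, (f i - f (i + 1)) * B := by
        refine (abs_add_le _ _).trans (add_le_add ?_ ((Finset.abs_sum_le_sum_abs _ _).trans
          (Finset.sum_le_sum fun i _ ↦ ?_)))
        · rw [abs_mul, abs_of_nonneg (hf0 n)]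
          exact mul_le_mul_of_nonneg_left (hv n) (hf0 n)
        · have h1 : 0 ≤ f i - f (i + 1) := sub_nonneg.2 (hf i.le_succ)
          rw [abs_mul, abs_of_nonneg h1]
          exact mul_le_mul_of_nonneg_left (hv _) h1
    _ = B * f 0 := by
        rw [← Finset.sum_mul, Finset.sum_range_sub']
        ring

theorem DirichletCharacter.norm_sum_range_le {N : ℕ} [NeZero N] {χ : DirichletCharacter ℂ N}
    (hχ : χ ≠ 1) (n : ℕ) : ‖∑ i ∈ Finset.range n, χ (i : ZMod N)‖ ≤ N := by
  have hN : ∑ i ∈ Finset.range N, χ (i : ZMod N) = 0 := by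
    rw [← MulChar.sum_eq_zero_of_ne_one hχ]
    obtain ⟨m, rfl⟩ : ∃ m, N = m + 1 := Nat.exists_eq_succ_of_ne_zero (NeZero.ne N)
    rw [← Fin.sum_univ_eq_sum_range (fun i ↦ χ (i : ZMod (m + 1)))]
    exact Finset.sum_congr rfl fun a _ ↦ congrArg χ (ZMod.natCast_zmod_val (n := m + 1) a)
  induction n using Nat.strong_induction_on with
  | _ n ih =>
    rcases lt_or_ge n N with h | h
    · calc _ ≤ ∑ i ∈ Finset.range n, (1 : ℝ) := norm_sum_le_of_le _ fun i _ ↦ χ.norm_le_one _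
        _ ≤ N := by simpa using h.le
    · obtain ⟨m, rfl⟩ := Nat.exists_eq_add_of_le h
      rw [Finset.sum_range_add, hN, zero_add]
      simpa using ih m (by have := NeZero.pos N; omega)

theorem exists_hasSum_lambert {v : ℕ → ℝ} (hv : ∀ n, |v n| ≤ 1) {t : ℝ} (ht : 0 < t) :
    ∃ S : ℝ, HasSum (fun n : ℕ ↦ (∑ d ∈ n.divisors, v d) * Real.exp (-n * t)) S ∧
      HasSum (fun d : ℕ ↦ v d * (1 / (Real.exp (d * t) - 1))) S := by
  have hexp : ∀ n : ℕ, Real.exp (-n * t) = Real.exp (-t) ^ n := fun n ↦ by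
    rw [← Real.exp_nat_mul]
    congr 1
    ring
  have hq : ‖Real.exp (-t)‖ < 1 := by
    rw [Real.norm_eq_abs, Real.abs_exp]
    exact Real.exp_lt_one_iff.2 (neg_neg_of_pos ht)
  have hs : Summable fun p : ℕ+ × ℕ+ ↦ v p.1 * Real.exp (-t) ^ (p.1 * p.2 : ℕ) := by
    refine (summable_prod_mul_pow 0 hq).of_norm_bounded fun p ↦ ?_
    rw [pow_zero, one_mul, norm_mul, norm_pow, Real.norm_eq_abs, Real.norm_eq_abs, Real.abs_exp]
    exact mul_le_of_le_one_left (by positivity) (hv _)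
  refine ⟨∑' p : ℕ+ × ℕ+, v p.1 * Real.exp (-t) ^ (p.1 * p.2 : ℕ), ?_, ?_⟩
  · rw [← PNat.coe_injective.hasSum_iff]
    · refine (((sigmaAntidiagonalEquivProd.hasSum_iff).2 hs.hasSum).sigma
        fun n ↦ hasSum_fintype _).congr_fun fun n ↦ ?_
      simp only [Function.comp_apply, hexp, Finset.sum_mul]
      rw [← Nat.sum_divisorsAntidiagonal (fun d _ ↦ v d * Real.exp (-t) ^ (n : ℕ)),
        Finset.univ_eq_attach,
        ← (n : ℕ).divisorsAntidiagonal.sum_attach fun x : ℕ × ℕ ↦ v x.1 * Real.exp (-t) ^ (n : ℕ)]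
      refine Finset.sum_congr rfl fun x _ ↦ ?_
      have := (Nat.mem_divisorsAntidiagonal.1 x.2).1
      simp [sigmaAntidiagonalEquivProd, divisorsAntidiagonalFactors, this]
    · intro m hm
      obtain rfl : m = 0 := by
        by_contra h0
        exact hm ⟨⟨m, Nat.pos_of_ne_zero h0⟩, rfl⟩
      simp
  · rw [← PNat.coe_injective.hasSum_iff]
    · refine hs.hasSum.prod_fiberwise fun d ↦ ?_
      have hd : (0 : ℝ) < d := by exact_mod_cast d.pos
      have h := (hasSum_exp_neg_mul (mul_pos hd ht)).mul_left (v d)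
      rw [← PNat.coe_injective.hasSum_iff] at h
      · refine h.congr_fun fun m ↦ ?_
        simp only [Function.comp_apply, if_neg m.ne_zero, one_mul]
        rw [← Real.exp_nat_mul]
        congr 2
        push_cast
        ring
      · intro m hm
        rw [if_pos]
        · ring
        · by_contra h0
          exact hm ⟨⟨m, Nat.pos_of_ne_zero h0⟩, rfl⟩
    · intro m hm
      obtain rfl : m = 0 := by
        by_contra h0
        exact hm ⟨⟨m, Nat.pos_of_ne_zero h0⟩, rfl⟩
      simp

theorem exists_abs_lambert_sub_le {v : ℕ → ℝ} (hv : ∀ n, |v n| ≤ 1) (hv0 : v 0 = 0) {B : ℝ}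
    (hB : ∀ n, |∑ i ∈ Finset.range n, v i| ≤ B) :
    ∃ (c : ℝ) (F : ℝ → ℝ), (∀ t : ℝ, 0 < t →
      HasSum (fun n : ℕ ↦ (∑ d ∈ n.divisors, v d) * Real.exp (-n * t)) (F t)) ∧
      ∀ t : ℝ, 0 < t → |F t - c / t| ≤ B := by
  have hB' : ∀ n, |∑ i ∈ Finset.range n, v (i + 1)| ≤ B := fun n ↦ by
    simpa [Finset.sum_range_succ', hv0] using hB (n + 1)
  have hB0 : 0 ≤ B := (abs_nonneg _).trans (hB 0)
  have hc : CauchySeq fun n ↦ ∑ i ∈ Finset.range n, (1 / ((i : ℝ) + 1)) • v (i + 1) := by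
    refine Antitone.cauchySeq_series_mul_of_tendsto_zero_of_bounded
      (fun i j hij ↦ one_div_le_one_div_of_le (by positivity) (by gcongr))
      tendsto_one_div_add_atTop_nhds_zero_nat (b := B) fun n ↦ hB' n
  obtain ⟨c, hc⟩ := cauchySeq_tendsto_of_complete hc
  choose! F hF1 hF2 using fun (t : ℝ) (ht : 0 < t) ↦ exists_hasSum_lambert hv ht
  refine ⟨c, F, hF1, fun t ht ↦ ?_⟩
  have h1 := (hF2 t ht)
  rw [← hasSum_nat_add_iff' 1] at h1
  simp only [Finset.range_one, Finset.sum_singleton, hv0, zero_mul, sub_zero] at h1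
  have h2 := (h1.tendsto_sum_nat.sub (hc.div_const t)).abs
  refine le_of_tendsto h2 (Eventually.of_forall fun n ↦ ?_)
  have h3 := abs_sum_mul_le_of_antitone
    (f := fun i : ℕ ↦ 1 / (((i + 1 : ℕ) : ℝ) * t) - 1 / (Real.exp (((i + 1 : ℕ) : ℝ) * t) - 1))
    (fun i j hij ↦ antitoneOn_one_div_sub_one_div_exp_sub_one
      (by simp only [mem_Ioi]; positivity) (by simp only [mem_Ioi]; positivity) (by gcongr))
    (fun i ↦ sub_nonneg.2 (one_div_exp_sub_one_le (by positivity))) hB' n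
  have h4 := one_div_le_one_div_exp_sub_one_add (t := ((0 + 1 : ℕ) : ℝ) * t) (by positivity)
  rw [← abs_neg]
  calc _ ≤ _ := le_of_eq_of_le ?_ h3
    _ ≤ B * 1 := by
      gcongr
      linarith
    _ = B := mul_one B
  congr 1
  rw [neg_sub, Finset.sum_div, ← Finset.sum_sub_distrib]
  refine Finset.sum_congr rfl fun i _ ↦ ?_
  push_cast
  rw [smul_eq_mul]
  field_simp

theorem DirichletCharacter.exists_abs_theta_sub_le {N : ℕ} [NeZero N] {χ : DirichletCharacter ℂ N}
    (hχ : χ ≠ 1) :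
    ∃ (c : ℝ) (F : ℝ → ℝ), (∀ t : ℝ, 0 < t →
      HasSum (fun n : ℕ ↦ (χ.zetaMul n).re * Real.exp (-n * t)) (F t)) ∧
      ∀ t : ℝ, 0 < t → |F t - c / t| ≤ N := by
  have hN : N ≠ 1 := by
    rintro rfl
    exact hχ (DirichletCharacter.level_one χ)
  have : Fact (1 < N) := ⟨by have := NeZero.pos N; omega⟩
  obtain ⟨c, F, h1, h2⟩ := exists_abs_lambert_sub_le (v := fun n ↦ (χ (n : ZMod N)).re) (B := N)
    (fun n ↦ (Complex.abs_re_le_norm _).trans (χ.norm_le_one _))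
    (by rw [Nat.cast_zero, MulChar.map_zero, Complex.zero_re])
    (fun n ↦ by
      rw [← Complex.re_sum]
      exact (Complex.abs_re_le_norm _).trans (norm_sum_range_le hχ n))
  refine ⟨c, F, fun t ht ↦ (h1 t ht).congr_fun fun n ↦ ?_, h2⟩
  rw [zetaMul, ArithmeticFunction.coe_zeta_mul_apply, Complex.re_sum]
  congr 1
  refine Finset.sum_congr rfl fun d hd ↦ ?_
  rw [χ.apply_eq_toArithmeticFunction_apply (Nat.pos_of_mem_divisors hd).ne']

end Lambert

section Bounds
open Filter Topology Set MeasureTheory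

theorem le_integral_truncated_theta {a : ℕ → ℝ} {F : ℝ → ℝ} {c B δ s : ℝ} (ha : ∀ n, 0 ≤ a n)
    (hF : ∀ t : ℝ, 0 < t → HasSum (fun n : ℕ ↦ a n * Real.exp (-n * t)) (F t))
    (hB : ∀ t : ℝ, 0 < t → |F t - c / t| ≤ B) (hδ : 0 < δ) (hs : 0 < s)
    (hF_int : IntegrableOn (fun t : ℝ ↦ t ^ (s - 1) * (F t - c * indicator (Ioc 0 δ) (·⁻¹) t))
      (Ioi 0)) {T : Finset ℕ} (hT : ∀ n ∈ T, 0 < n ∧ 1 ≤ a n) :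
    Real.Gamma s * ∑ n ∈ T, (1 / (n : ℝ)) ^ s - (B + T.card) * (δ ^ s / s) ≤
      ∫ t in Ioi 0, t ^ (s - 1) * (F t - c * indicator (Ioc 0 δ) (·⁻¹) t) := by
  have h1 : ∀ n ∈ T, IntegrableOn (fun t : ℝ ↦ t ^ (s - 1) * Real.exp (-(n * t))) (Ioi 0) :=
    fun n hn ↦ by
      have := integrableOn_rpow_mul_exp_neg_mul_rpow (p := 1) (s := s - 1) (b := n) (by linarith)
        one_pos (by exact_mod_cast (hT n hn).1)
      simpa only [Real.rpow_one, neg_mul] using this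
  have h2 : IntegrableOn (fun t : ℝ ↦ ∑ n ∈ T, t ^ (s - 1) * Real.exp (-(n * t))) (Ioi 0) :=
    integrable_finsetSum _ h1
  have h3 : IntegrableOn (indicator (Ioc 0 δ) fun t : ℝ ↦ t ^ (s - 1)) (Ioi 0) := by
    have := (intervalIntegral.intervalIntegrable_rpow' (a := 0) (b := δ) (r := s - 1) (by linarith))
    rw [intervalIntegrable_iff_integrableOn_Ioc_of_le hδ.le] at this
    exact (this.integrable_indicator measurableSet_Ioc).integrableOn
  have h4 : ∫ t in Ioi 0, indicator (Ioc 0 δ) (fun t : ℝ ↦ t ^ (s - 1)) t = δ ^ s / s := by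
    rw [setIntegral_indicator measurableSet_Ioc, inter_eq_self_of_subset_right Ioc_subset_Ioi_self,
      ← intervalIntegral.integral_of_le hδ.le, integral_rpow (Or.inl (by linarith))]
    simp [Real.zero_rpow hs.ne']
  have h5 : ∫ t in Ioi 0, ∑ n ∈ T, t ^ (s - 1) * Real.exp (-(n * t)) =
      Real.Gamma s * ∑ n ∈ T, (1 / (n : ℝ)) ^ s := by
    rw [integral_finsetSum _ h1, Finset.mul_sum]
    refine Finset.sum_congr rfl fun n hn ↦ ?_
    rw [Real.integral_rpow_mul_exp_neg_mul_Ioi hs (by exact_mod_cast (hT n hn).1), mul_comm]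
  rw [← h5, ← h4, ← integral_const_mul, ← integral_sub h2 (h3.const_mul _)]
  refine setIntegral_mono_on (h2.sub (h3.const_mul _)) hF_int measurableSet_Ioi
    fun t (ht : 0 < t) ↦ ?_
  have ht' : 0 ≤ t ^ (s - 1) := (Real.rpow_pos_of_pos ht _).le
  rw [← Finset.mul_sum]
  by_cases h : t ∈ Ioc 0 δ
  · rw [indicator_of_mem h, indicator_of_mem h, mul_comm (B + _), ← mul_sub]
    refine mul_le_mul_of_nonneg_left ?_ ht'
    have h6 := (abs_le.1 (hB t ht)).1
    have h7 : ∑ n ∈ T, Real.exp (-(n * t)) ≤ ∑ n ∈ T, 1 :=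
      Finset.sum_le_sum fun n _ ↦ Real.exp_le_one_iff.2 (neg_nonpos.2 (by positivity))
    rw [Finset.sum_const, nsmul_one] at h7
    rw [← div_eq_mul_inv]
    linarith
  · rw [indicator_of_notMem h, indicator_of_notMem h, mul_zero, mul_zero, sub_zero, sub_zero]
    refine mul_le_mul_of_nonneg_left ?_ ht'
    refine le_trans (Finset.sum_le_sum fun n hn ↦ ?_)
      (sum_le_hasSum T (fun n _ ↦ mul_nonneg (ha n) (Real.exp_pos _).le) (hF t ht))
    rw [neg_mul]
    exact le_mul_of_one_le_left (Real.exp_pos _).le (hT n hn).2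

theorem one_le_Gamma {s : ℝ} (hs : 0 < s) (hs1 : s < 1) : 1 ≤ Real.Gamma s := by
  have h := Real.convexOn_Gamma.slope_mono_adjacent (mem_Ioi.2 hs)
    (mem_Ioi.2 (two_pos : (0 : ℝ) < 2)) hs1 one_lt_two
  rw [Real.Gamma_one, Real.Gamma_two, sub_self, zero_div,
    div_le_iff₀ (by linarith), zero_mul] at h
  linarith

end Bounds

namespace DirichletCharacter
open Filter Topology Set MeasureTheory

variable {N : ℕ} {χ : DirichletCharacter ℂ N}

theorem ofReal_zetaMul_re (hsq : χ ^ 2 = 1) (n : ℕ) : ((χ.zetaMul n).re : ℂ) = χ.zetaMul n :=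
  Complex.ext rfl (Complex.le_def.1 (zetaMul_nonneg hsq n)).2

theorem zetaMul_re_nonneg (hsq : χ ^ 2 = 1) (n : ℕ) : 0 ≤ (χ.zetaMul n).re :=
  (Complex.le_def.1 (zetaMul_nonneg hsq n)).1

theorem one_le_zetaMul_prime_pow_re (hsq : χ ^ 2 = 1) {p k : ℕ} (hp : p.Prime)
    (hk : _root_.Even k) :
    1 ≤ (χ.zetaMul (p ^ k)).re := by
  rw [χ.zetaMul_prime_pow hp]
  rcases MulChar.isQuadratic_iff_sq_eq_one.mpr hsq p with h | h | h
  · rw [h, Finset.sum_range_succ']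
    simp
  · simp [h]
  · rw [h, neg_one_geom_sum, if_neg (Nat.not_even_iff_odd.2 hk.add_one)]
    simp

variable [NeZero N]

theorem LSeries_zetaMul_eq {s : ℂ} (hs : 1 < s.re) :
    LSeries χ.zetaMul s = riemannZeta s * LFunction χ s := by
  rw [zetaMul, ← ArithmeticFunction.coe_mul, LSeries_convolution', LFunction_eq_LSeries χ hs]
  · congr 1
    · simp_rw [← ArithmeticFunction.LSeries_zeta_eq_riemannZeta hs,
        ← ArithmeticFunction.natCoe_apply]
    · exact LSeries_congr (fun h ↦ (χ.apply_eq_toArithmeticFunction_apply h).symm) s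
  · exact ArithmeticFunction.LSeriesSummable_zeta_iff.mpr hs
  · exact (LSeriesSummable_congr _ fun h ↦ (χ.apply_eq_toArithmeticFunction_apply h).symm).2
      (ZMod.LSeriesSummable_of_one_lt_re χ hs)

/-- The entire function `(s - 1) * ζ s * L(s, χ)`, with its value at `s = 1` filled in. -/
noncomputable def subOneMulZetaMul (χ : DirichletCharacter ℂ N) (s : ℂ) : ℂ :=
  LFunctionTrivChar₁ 1 s * LFunction χ s

theorem differentiable_subOneMulZetaMul (hχ : χ ≠ 1) : Differentiable ℂ (subOneMulZetaMul χ) :=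
  (differentiable_LFunctionTrivChar₁ 1).mul (differentiable_LFunction hχ)

theorem subOneMulZetaMul_one : subOneMulZetaMul χ 1 = LFunction χ 1 := by
  rw [subOneMulZetaMul, LFunctionTrivChar₁_one_apply_one, one_mul]

theorem subOneMulZetaMul_of_ne {s : ℂ} (hs : s ≠ 1) :
    subOneMulZetaMul χ s = (s - 1) * riemannZeta s * LFunction χ s := by
  rw [subOneMulZetaMul, LFunctionTrivChar₁_one_apply hs]

theorem subOneMulZetaMul_of_one_lt_re {s : ℂ} (hs : 1 < s.re) :
    subOneMulZetaMul χ s = (s - 1) * LSeries χ.zetaMul s := by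
  rw [subOneMulZetaMul_of_ne, LSeries_zetaMul_eq hs, mul_assoc]
  rintro rfl
  simp at hs

theorem tendsto_sub_one_mul_LSeries_zetaMul (hχ : χ ≠ 1) :
    Tendsto (fun s : ℝ ↦ ((s : ℂ) - 1) * LSeries χ.zetaMul s) (𝓝[>] 1) (𝓝 (LFunction χ 1)) := by
  have h : Continuous fun s : ℝ ↦ subOneMulZetaMul χ s :=
    (differentiable_subOneMulZetaMul hχ).continuous.comp Complex.continuous_ofReal
  have h1 := (h.tendsto 1).mono_left (nhdsWithin_le_nhds (s := Ioi 1))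
  rw [Complex.ofReal_one, subOneMulZetaMul_one] at h1
  refine h1.congr' ?_
  filter_upwards [self_mem_nhdsWithin] with s (hs : 1 < s)
  exact subOneMulZetaMul_of_one_lt_re hs

/-- If `L(s, χ)` has no zero in `[s, 1)`, then `L(1, χ)` is bounded below. -/
theorem LFunction_one_re_lower_bound (hχ : χ ≠ 1) (hsq : χ ^ 2 = 1) {s δ : ℝ} (hs : 1 / 2 < s)
    (hs1 : s < 1) (hδ : 0 < δ) (hz : ∀ x : ℝ, s ≤ x → x < 1 → LFunction χ x ≠ 0) {T : Finset ℕ}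
    (hT : ∀ n ∈ T, 0 < n ∧ 1 ≤ (χ.zetaMul n).re) :
    ∑ n ∈ T, (1 / (n : ℝ)) ^ s - (N + T.card) * (δ ^ s / s) ≤
      (LFunction χ 1).re * δ ^ (s - 1) / (1 - s) := by
  obtain ⟨c, F, hF, hB⟩ := exists_abs_theta_sub_le hχ
  have hre : (fun n ↦ ((χ.zetaMul n).re : ℂ)) = χ.zetaMul := funext (ofReal_zetaMul_re hsq)
  have key := fun (x : ℝ) (hx : 0 < x) ↦ Gamma_mul_eq_integral (by simp) hF
    (fun t ht _ ↦ hB t ht) hδ (fun s hs ↦ by rw [hre]; exact χ.LSeriesSummable_zetaMul hs)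
    (differentiable_subOneMulZetaMul hχ)
    (fun s hs ↦ by rw [hre]; exact subOneMulZetaMul_of_one_lt_re hs) hx
  have hc : LFunction χ 1 = c := by
    have h := (key 1 one_pos).2
    rw [Real.Gamma_one, Complex.ofReal_one, one_mul, subOneMulZetaMul_one] at h
    rw [h]
    simp
  have hF0 : ∀ t : ℝ, 0 < t → 0 ≤ F t := fun t ht ↦
    (hF t ht).nonneg fun n ↦ mul_nonneg (zetaMul_re_nonneg hsq n) (Real.exp_pos _).le
  have hc0 : 0 ≤ c := by
    by_contra! h
    have hN : (0 : ℝ) < N := by exact_mod_cast NeZero.pos N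
    have ht : 0 < -c / (2 * N) := div_pos (by linarith) (by linarith)
    have h1 := (abs_le.1 (hB _ ht)).2
    have h2 := hF0 _ ht
    have h3 : c / (-c / (2 * N)) = -(2 * N) := by
      have := h.ne
      field_simp
    linarith
  have hc1 : 0 < c := by
    refine hc0.lt_of_ne' fun h ↦ LFunction_apply_one_ne_zero hχ ?_
    rw [hc, h, Complex.ofReal_zero]
  have hreal : ∀ x : ℝ, s ≤ x → x < 1 → (LFunction χ x).im = 0 := fun x hx hx1 ↦ by
    obtain ⟨z, hz0, hz1⟩ := exists_riemannZeta_eq_neg (hs.trans_le hx) hx1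
    have h := (key x (by linarith)).2
    have hx1' : (x : ℂ) ≠ 1 := by exact_mod_cast hx1.ne
    rw [subOneMulZetaMul_of_ne hx1', hz1] at h
    have h1 := congrArg Complex.im h
    rw [Complex.ofReal_im, show (Real.Gamma x : ℂ) * (((x : ℂ) - 1) * z * LFunction χ x) =
      ((Real.Gamma x * ((x - 1) * z) : ℝ) : ℂ) * LFunction χ x by push_cast; ring,
      Complex.im_ofReal_mul] at h1
    refine (mul_eq_zero.1 h1).resolve_left ?_
    exact (mul_pos (Real.Gamma_pos_of_pos (by linarith))
      (mul_pos_of_neg_of_neg (by linarith) hz0)).ne'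
  have hpos : 0 < (LFunction χ s).re := by
    by_contra! h
    have hcont : Continuous fun x : ℝ ↦ (LFunction χ x).re :=
      Complex.continuous_re.comp
        ((differentiable_LFunction hχ).continuous.comp Complex.continuous_ofReal)
    obtain ⟨x, hx, hx0⟩ := intermediate_value_Icc hs1.le hcont.continuousOn
      (show (0 : ℝ) ∈ _ from ⟨h, by rw [Complex.ofReal_one, hc]; exact hc0⟩)
    have hx1 : x < 1 := hx.2.lt_of_ne fun hx1 ↦ by
      simp only [hx1, Complex.ofReal_one, hc, Complex.ofReal_re] at hx0
      exact hc1.ne' hx0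
    exact hz x hx.1 hx1 (Complex.ext hx0 (hreal x hx.1 hx1))
  obtain ⟨hF_int, hkey⟩ := key s (by linarith)
  have hle := le_integral_truncated_theta (zetaMul_re_nonneg hsq) hF hB hδ (by linarith) hF_int hT
  obtain ⟨z, hz0, hz1⟩ := exists_riemannZeta_eq_neg hs hs1
  have hL : LFunction χ s = ((LFunction χ s).re : ℂ) :=
    Complex.ext rfl (hreal s le_rfl hs1)
  have hs1' : (s : ℂ) ≠ 1 := by exact_mod_cast hs1.ne
  have hG := one_le_Gamma (by linarith) hs1
  set I := ∫ t in Ioi 0, t ^ (s - 1) * (F t - c * indicator (Ioc 0 δ) (·⁻¹) t)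
  rw [subOneMulZetaMul_of_ne hs1', hz1, hL] at hkey
  have hkey' : Real.Gamma s * ((s - 1) * z * (LFunction χ s).re) =
      (s - 1) * I + c * δ ^ (s - 1) := by exact_mod_cast hkey
  have h1 : 0 < Real.Gamma s * ((s - 1) * z * (LFunction χ s).re) :=
    mul_pos (by linarith) (mul_pos (mul_pos_of_neg_of_neg (by linarith) hz0) hpos)
  have h2 : ∑ n ∈ T, (1 / (n : ℝ)) ^ s ≤ Real.Gamma s * ∑ n ∈ T, (1 / (n : ℝ)) ^ s :=
    le_mul_of_one_le_left (Finset.sum_nonneg fun n _ ↦ by positivity) hG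
  rw [hc, Complex.ofReal_re, le_div_iff₀ (by linarith)]
  rw [hkey'] at h1
  have h3 : (∑ n ∈ T, (1 / (n : ℝ)) ^ s - (N + T.card) * (δ ^ s / s)) * (1 - s) ≤ I * (1 - s) :=
    mul_le_mul_of_nonneg_right (by linarith) (by linarith)
  linarith

/-- If `L(s, χ)` has no zero in `[1 - 1 / (4 * log N), 1)`, then `L(1, χ) > 0.655 / (e * log N)`. -/
theorem LFunction_one_re_gt {N : ℕ} [NeZero N] {χ : DirichletCharacter ℂ N} (hχ : χ ≠ 1)
    (hsq : χ ^ 2 = 1) (hN : Real.exp 11.2 < N)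
    (hz : ∀ x : ℝ, 1 - 1 / (4 * Real.log N) ≤ x → x < 1 → LFunction χ x ≠ 0) :
    0.655 / (Real.exp 1 * Real.log N) < (LFunction χ 1).re := by
  have hN0 : (0 : ℝ) < N := (Real.exp_pos _).trans hN
  have hl : 11.2 < Real.log N := (Real.lt_log_iff_exp_lt hN0).2 hN
  have hNl : (N : ℝ) = Real.exp (Real.log N) := (Real.exp_log hN0).symm
  set l := Real.log N
  obtain ⟨s, hs⟩ : ∃ s, s = 1 - 1 / (4 * l) := ⟨_, rfl⟩
  have hsl : 1 - s = 1 / (4 * l) := by rw [hs]; ring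
  have hs1 : s < 1 := by
    have : 0 < 1 / (4 * l) := by positivity
    linarith
  have hs0 : 0.97 < s := by
    have : 1 / (4 * l) < 0.03 := by rw [div_lt_iff₀ (by linarith)]; linarith
    linarith
  have hT : ∀ n ∈ ({1, 4, 9, 16} : Finset ℕ), 0 < n ∧ 1 ≤ (χ.zetaMul n).re := by
    simp only [Finset.mem_insert, Finset.mem_singleton, forall_eq_or_imp, forall_eq]
    have h2 := fun k hk ↦ one_le_zetaMul_prime_pow_re (k := k) hsq Nat.prime_two hk
    have h3 := one_le_zetaMul_prime_pow_re hsq Nat.prime_three even_two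
    exact ⟨⟨by norm_num, h2 0 (by decide)⟩, ⟨by norm_num, h2 2 (by decide)⟩, ⟨by norm_num, h3⟩,
      ⟨by norm_num, h2 4 (by decide)⟩⟩
  have key := LFunction_one_re_lower_bound hχ hsq (by linarith) hs1 (Real.exp_pos (-4 * l / 3))
    (fun x hx hx1 ↦ hz x (hs ▸ hx) hx1) hT
  have hexp1 : Real.exp (-4 * l / 3) ^ (s - 1) = Real.exp (1 / 3) := by
    rw [← Real.exp_mul, ← neg_sub 1 s, hsl]
    congr 1
    field_simp
  have hexp : Real.exp (-4 * l / 3) ^ s = Real.exp (-4 * l / 3) * Real.exp (1 / 3) := by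
    rw [← hexp1, ← Real.rpow_one_add' (Real.exp_pos _).le (by linarith), add_sub_cancel]
  have hsum : (1.4236 : ℝ) ≤ ∑ n ∈ ({1, 4, 9, 16} : Finset ℕ), (1 / (n : ℝ)) ^ s := by
    have h : ∑ n ∈ ({1, 4, 9, 16} : Finset ℕ), 1 / (n : ℝ) ≤
        ∑ n ∈ ({1, 4, 9, 16} : Finset ℕ), (1 / (n : ℝ)) ^ s := by
      refine Finset.sum_le_sum fun n hn ↦ ?_
      have hn1 : (1 : ℝ) ≤ n := by exact_mod_cast (hT n hn).1
      have := Real.rpow_le_rpow_of_exponent_ge (x := 1 / (n : ℝ)) (by positivity)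
        ((div_le_one (by linarith)).2 hn1) hs1.le
      rwa [Real.rpow_one] at this
    refine le_trans ?_ h
    norm_num
  have he := Real.exp_one_gt_d9
  have he' := Real.exp_one_lt_d9
  obtain ⟨a, ha⟩ : ∃ a, a = Real.exp (1 / 3) := ⟨_, rfl⟩
  have ha0 : 0 < a := ha ▸ Real.exp_pos _
  have ha3 : a ^ 3 = Real.exp 1 := by
    rw [ha, ← Real.exp_nat_mul]
    norm_num
  have ha1 : 1.3956 < a := by
    refine lt_of_pow_lt_pow_left₀ 3 ha0.le ?_
    rw [ha3]
    norm_num at he ⊢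
    linarith
  have ha2 : a < 1.3957 := by
    refine lt_of_pow_lt_pow_left₀ 3 (by norm_num) ?_
    rw [ha3]
    norm_num at he' ⊢
    linarith
  have herr : ((N : ℝ) + 4) * Real.exp (-4 * l / 3) ≤ 0.03 := by
    obtain ⟨b, hb⟩ : ∃ b, b = Real.exp (-l / 3) := ⟨_, rfl⟩
    have hb0 : 0 < b := hb ▸ Real.exp_pos _
    have hb4 : Real.exp (-4 * l / 3) = b ^ 4 := by
      rw [hb, ← Real.exp_nat_mul]
      congr 1
      push_cast
      ring
    have hNb : (N : ℝ) * b ^ 4 = b := by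
      rw [hNl, ← hb4, hb, ← Real.exp_add]
      congr 1
      ring
    have hab : a ^ 11 * b < 1 := by
      rw [ha, hb, ← Real.exp_nat_mul, ← Real.exp_add, Real.exp_lt_one_iff]
      push_cast
      linarith
    have ha11 : (38 : ℝ) ≤ a ^ 11 :=
      le_trans (by norm_num) (pow_le_pow_left₀ (by norm_num) ha1.le 11)
    have hb1 : b < 0.027 := by nlinarith
    have hb2 : b ^ 4 ≤ 0.027 ^ 4 := pow_le_pow_left₀ hb0.le hb1.le 4
    rw [hb4, add_mul, hNb]
    norm_num at hb1 hb2 ⊢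
    linarith
  rw [hexp, hexp1, ← ha, hsl, div_div_eq_mul_div, div_one,
    show ({1, 4, 9, 16} : Finset ℕ).card = 4 from rfl, Nat.cast_ofNat] at key
  have herr' : ((N : ℝ) + 4) * (Real.exp (-4 * l / 3) * a / s) ≤ 0.0436 := by
    rw [← mul_div_assoc, ← mul_assoc, div_le_iff₀ (by linarith)]
    nlinarith
  rw [div_lt_iff₀ (by positivity), ← ha3]
  have h1 : 0.345 ≤ (LFunction χ 1).re * a * l := by linarith
  have h2 : 1.94 ≤ a ^ 2 := by nlinarith
  have h3 := mul_le_mul h1 h2 (by norm_num) (by linarith)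
  linarith

end DirichletCharacter

/-- If `D < 0` is a fundamental discriminant with `|D| > e^{11.2}` and `L(s, χ_D)` has no real
zero with `1 − 1/(4 log|D|) ≤ s < 1`, then `h(D) > (0.655/(π e))·√|D|/log|D|`. -/
theorem classNumber_gt_of_no_siegel_zero
    (D : ℤ) (hfund : IsFundamentalDiscriminant D) (hneg : D < 0)
    (hD : Real.exp 11.2 < |(D : ℝ)|)
    (χ : DirichletCharacter ℂ D.natAbs) (hχ : IsKroneckerChar D χ)
    (hnozero : ∀ s : ℝ, 1 - 1 / (4 * Real.log |(D : ℝ)|) ≤ s → s < 1 → LFunc χ (s : ℂ) ≠ 0) :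
    ∀ (K : Type) [Field K] [NumberField K], Module.finrank ℚ K = 2 →
      NumberField.discr K = D →
        0.655 / (Real.pi * Real.exp 1) * (Real.sqrt |(D : ℝ)| / Real.log |(D : ℝ)|)
          < (NumberField.classNumber K : ℝ) := by
  intro K _ _ hK hdisc
  have hN : D.natAbs ≠ 0 := by omega
  have : NeZero D.natAbs := ⟨hN⟩
  have habs : |(D : ℝ)| = (D.natAbs : ℝ) := by rw [Nat.cast_natAbs, Int.cast_abs]
  have hχ1 := hχ.ne_one hneg hfund.emod_four
  have h1 := DirichletCharacter.LFunction_one_re_gt hχ1 (hχ.sq_eq_one hneg.ne) (habs ▸ hD)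
    fun x hx hx1 ↦ by
      have := hnozero x (habs ▸ hx) hx1
      rwa [LFunc, dif_neg hN] at this
  have h2 := re_le_dedekindZeta_residue hK hneg hdisc hχ
    (DirichletCharacter.tendsto_sub_one_mul_LSeries_zetaMul hχ1)
  have h3 := dedekindZeta_residue_le hK (hdisc ▸ hneg)
  rw [hdisc] at h3
  rw [← habs] at h1
  have hD0 : 0 < |(D : ℝ)| := (Real.exp_pos _).trans hD
  have hsqrt := Real.sqrt_pos.2 hD0
  have hpi := Real.pi_pos
  have h4 := (h1.trans_le h2).trans_le h3
  rw [lt_div_iff₀ hsqrt] at h4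
  rw [← mul_lt_mul_iff_right₀ hpi]
  refine lt_of_eq_of_lt ?_ h4
  field_simp
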